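/- Let u be a positive smooth solution of Δu = (n(n−2)/4)u^{(n+2)/(n−2)} on a connected domain Ω ⊂ ℝⁿ, n ≥ 3, such that the matrix M = (u_{ij}/u − (n/(n−2))u_iu_j/u²) is positive semidefinite on Ω. If at some point x₀ ∈ Ω one has M_{ii}(x₀) = 0 and ∇u(x₀) = 0 for some index i, then u_{ii} ≡ 0 on Ω. -/

import Mathlib

open scoped BigOperators

noncomputable def pd {n : ℕ} (i : Fin n) (f : (Fin n → ℝ) → ℝ) (x : Fin n → ℝ) : ℝ :=
  fderiv ℝ f x (Pi.single i 1)

noncomputable def pd2 {n : ℕ} (i j : Fin n) (f : (Fin n → ℝ) → ℝ) (x : Fin n → ℝ) : ℝ :=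
  pd i (fun y => pd j f y) x

noncomputable def lap {n : ℕ} (f : (Fin n → ℝ) → ℝ) (x : Fin n → ℝ) : ℝ :=
  ∑ i, pd2 i i f x

/-- The matrix `M = (u_{ij}/u − (n/(n−2)) uᵢuⱼ/u²)`. -/
noncomputable def Mmat {n : ℕ} (u : (Fin n → ℝ) → ℝ) (x : Fin n → ℝ) :
    Matrix (Fin n) (Fin n) ℝ :=
  Matrix.of fun i j =>
    pd2 i j u x / u x - ((n : ℝ) / ((n : ℝ) - 2)) * pd i u x * pd j u x / (u x) ^ 2

open Set Filter Topology

lemma deriv_deriv_nonneg_of_isLocalMin {f : ℝ → ℝ} {x : ℝ} (h : IsLocalMin f x)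
    (hc : ContinuousAt f x) : 0 ≤ deriv (deriv f) x := by
  by_contra! hneg
  have hmax := isLocalMax_of_deriv_deriv_neg hneg h.deriv_eq_zero hc
  have hconst : f =ᶠ[𝓝 x] fun _ => f x := by
    filter_upwards [h, hmax] with y h₁ h₂ using le_antisymm h₂ h₁
  have hzero := hconst.deriv.deriv_eq
  simp at hzero
  linarith

section PartialDerivatives

variable {n : ℕ} {Ω : Set (Fin n → ℝ)} {f g : (Fin n → ℝ) → ℝ}

lemma ContDiffOn.pd {k m : WithTop ℕ∞} (hΩ : IsOpen Ω) (hf : ContDiffOn ℝ k f Ω)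
    (hm : m + 1 ≤ k) (i : Fin n) : ContDiffOn ℝ m (pd i f) Ω :=
  (hf.fderiv_of_isOpen hΩ hm).clm_apply contDiffOn_const

lemma Set.EqOn.pd (hΩ : IsOpen Ω) (h : EqOn f g Ω) (i : Fin n) : EqOn (pd i f) (pd i g) Ω := by
  intro x hx
  have hfg : f =ᶠ[𝓝 x] g := h.eventuallyEq_of_mem (hΩ.mem_nhds hx)
  simp only [_root_.pd, hfg.fderiv_eq]

lemma pd_comm (hΩ : IsOpen Ω) (hf : ContDiffOn ℝ 2 f Ω) (i j : Fin n) :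
    EqOn (pd i (pd j f)) (pd j (pd i f)) Ω := by
  intro x hx
  have hfx : ContDiffAt ℝ 2 f x := hf.contDiffAt (hΩ.mem_nhds hx)
  have hd : DifferentiableAt ℝ (fderiv ℝ f) x :=
    (hfx.fderiv_right (m := 1) (by norm_num)).differentiableAt (by norm_num)
  have key : ∀ a b : Fin n, pd a (pd b f) x
      = fderiv ℝ (fderiv ℝ f) x (Pi.single a 1) (Pi.single b 1) := by
    intro a b
    have : HasFDerivAt (fun y => fderiv ℝ f y (Pi.single b 1))
        ((fderiv ℝ (fderiv ℝ f) x).flip (Pi.single b 1)) x := by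
      simpa using hd.hasFDerivAt.clm_apply (hasFDerivAt_const (Pi.single b (1 : ℝ)) x)
    change fderiv ℝ (fun y => fderiv ℝ f y (Pi.single b 1)) x (Pi.single a 1) = _
    rw [this.fderiv]
    rfl
  rw [key, key]
  exact (hfx.isSymmSndFDerivAt (by simp)) _ _

lemma pd_sum {ι : Type*} (s : Finset ι) (F : ι → (Fin n → ℝ) → ℝ) (i : Fin n) {x : Fin n → ℝ}
    (hF : ∀ k ∈ s, DifferentiableAt ℝ (F k) x) :
    pd i (fun y => ∑ k ∈ s, F k y) x = ∑ k ∈ s, pd i (F k) x := by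
  simp only [pd]
  rw [fderiv_fun_sum hF]
  simp

lemma lap_pd2 (hΩ : IsOpen Ω) (hf : ContDiffOn ℝ (⊤ : ℕ∞) f Ω) (i : Fin n) :
    EqOn (lap (pd2 i i f)) (pd2 i i (lap f)) Ω := by
  have smooth : ∀ {g : (Fin n → ℝ) → ℝ} (j : Fin n), ContDiffOn ℝ (⊤ : ℕ∞) g Ω →
      ContDiffOn ℝ (⊤ : ℕ∞) (pd j g) Ω := fun j hg => hg.pd hΩ (by simp) j
  have comm : ∀ {g : (Fin n → ℝ) → ℝ} (a b : Fin n), ContDiffOn ℝ (⊤ : ℕ∞) g Ω →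
      EqOn (pd a (pd b g)) (pd b (pd a g)) Ω := fun a b hg =>
    pd_comm hΩ (hg.of_le ENat.LEInfty.out) a b
  have diff : ∀ {g : (Fin n → ℝ) → ℝ} {x}, ContDiffOn ℝ (⊤ : ℕ∞) g Ω → x ∈ Ω →
      DifferentiableAt ℝ g x := fun hg hx =>
    (hg.contDiffAt (hΩ.mem_nhds hx)).differentiableAt (by simp)
  have swap : ∀ j, EqOn (pd j (pd j (pd i (pd i f)))) (pd i (pd i (pd j (pd j f)))) Ω := by
    intro j
    have h₁ : EqOn (pd j (pd i (pd i f))) (pd i (pd i (pd j f))) Ω :=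
      (comm j i (smooth i hf)).trans ((comm j i hf).pd hΩ i)
    have h₂ : EqOn (pd j (pd i (pd i (pd j f)))) (pd i (pd i (pd j (pd j f)))) Ω :=
      (comm j i (smooth i (smooth j hf))).trans ((comm j i (smooth j hf)).pd hΩ i)
    exact (h₁.pd hΩ j).trans h₂
  have hsum : EqOn (pd i (lap f)) (fun x => ∑ j, pd i (pd j (pd j f)) x) Ω := fun x hx =>
    pd_sum _ (fun j => pd j (pd j f)) i fun j _ => diff (smooth j (smooth j hf)) hx
  intro x hx
  calc lap (pd2 i i f) x = ∑ j, pd i (pd i (pd j (pd j f))) x :=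
        Finset.sum_congr rfl fun j _ => swap j hx
    _ = pd i (fun x => ∑ j, pd i (pd j (pd j f)) x) x :=
        (pd_sum _ (fun j => pd i (pd j (pd j f))) i
          fun j _ => diff (smooth i (smooth j (smooth j hf))) hx).symm
    _ = pd2 i i (lap f) x := (hsum.pd hΩ i hx).symm

lemma hasDerivAt_line {x : Fin n → ℝ} {t : ℝ} (i : Fin n)
    (hf : DifferentiableAt ℝ f (x + t • Pi.single i 1)) :
    HasDerivAt (fun s : ℝ => f (x + s • Pi.single i 1)) (pd i f (x + t • Pi.single i 1)) t := by
  have hl : HasDerivAt (fun s : ℝ => x + s • (Pi.single i 1 : Fin n → ℝ)) (Pi.single i 1) t := by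
    simpa using ((hasDerivAt_id t).smul_const (Pi.single i (1 : ℝ))).const_add x
  exact hf.hasFDerivAt.comp_hasDerivAt t hl

end PartialDerivatives

section Barrier

variable {n : ℕ}

/-- The square of the Euclidean distance between two points of `Fin n → ℝ`. -/
def sqDist (y x : Fin n → ℝ) : ℝ := ∑ j, (x j - y j) ^ 2

@[fun_prop]
lemma continuous_sqDist (y : Fin n → ℝ) : Continuous (sqDist y) := by
  unfold sqDist
  fun_prop

lemma sqDist_pos {y x : Fin n → ℝ} (h : x ≠ y) : 0 < sqDist y x := by
  obtain ⟨j, hj⟩ := Function.ne_iff.1 h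
  have := sq_pos_of_ne_zero (sub_ne_zero.2 hj)
  exact this.trans_le
    (Finset.single_le_sum (f := fun j => (x j - y j) ^ 2) (fun j _ => sq_nonneg _)
      (Finset.mem_univ j))

lemma sqDist_line (y x : Fin n → ℝ) (i : Fin n) (t : ℝ) :
    sqDist y (x + t • Pi.single i 1) = sqDist y x + 2 * (x i - y i) * t + t ^ 2 := by
  have : ∀ j, ((x + t • (Pi.single i 1 : Fin n → ℝ)) j - y j) ^ 2
      = (x j - y j) ^ 2 + if j = i then 2 * (x i - y i) * t + t ^ 2 else 0 := by
    intro j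
    by_cases h : j = i
    · subst h
      simp
      ring
    · simp [h]
  simp only [sqDist, this, Finset.sum_add_distrib, Finset.sum_ite_eq', Finset.mem_univ, if_true]
  ring

/-- If `z` lies on the boundary of a Euclidean ball centred at `y`, then the closed ball with diameter
`[y, z]` is contained in the open ball, except for `z`. -/
lemma sqDist_lt_of_sqDist_midpoint_le {y z x : Fin n → ℝ} (hxz : x ≠ z)
    (h : sqDist (fun j => (y j + z j) / 2) x ≤ sqDist (fun j => (y j + z j) / 2) z) :
    sqDist y x < sqDist y z := by
  have hpos := sqDist_pos hxz
  have key : sqDist y x + sqDist z x - sqDist y z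
      = 2 * (sqDist (fun j => (y j + z j) / 2) x - sqDist (fun j => (y j + z j) / 2) z) := by
    simp only [sqDist, ← Finset.sum_add_distrib, ← Finset.sum_sub_distrib, Finset.mul_sum]
    refine Finset.sum_congr rfl fun j _ => ?_
    ring
  linarith

lemma dist_le_of_sqDist_le {y x x₀ : Fin n → ℝ} (h : sqDist y x ≤ sqDist y x₀) :
    dist x y ≤ n * dist x₀ y := by
  refine (dist_pi_le_iff (by positivity)).2 fun j => ?_
  have hn : (1 : ℝ) ≤ n := by exact_mod_cast Nat.one_le_of_lt j.2
  have h₁ : (x j - y j) ^ 2 ≤ sqDist y x :=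
    Finset.single_le_sum (f := fun j => (x j - y j) ^ 2) (fun j _ => sq_nonneg _)
      (Finset.mem_univ j)
  have h₂ : sqDist y x₀ ≤ n * dist x₀ y ^ 2 := by
    calc sqDist y x₀ ≤ ∑ _j : Fin n, dist x₀ y ^ 2 := by
          refine Finset.sum_le_sum fun k _ => ?_
          rw [← sq_abs, ← Real.dist_eq]
          exact pow_le_pow_left₀ dist_nonneg (dist_le_pi_dist x₀ y k) 2
      _ = n * dist x₀ y ^ 2 := by simp
  rw [Real.dist_eq]
  refine abs_le_of_sq_le_sq ?_ (by positivity)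
  nlinarith [mul_nonneg (sub_nonneg.2 hn)
    (mul_nonneg (zero_le_one.trans hn) (sq_nonneg (dist x₀ y)))]

/-- At an interior local minimum of `f - ε exp (-α r²)`, the Laplacian of `f` dominates that of
`ε exp (-α r²)`. -/
lemma le_lap_of_isLocalMin {Ω : Set (Fin n → ℝ)} (hΩ : IsOpen Ω) {f : (Fin n → ℝ) → ℝ}
    (hf : ContDiffOn ℝ 2 f Ω) {p y : Fin n → ℝ} (hp : p ∈ Ω) {ε α : ℝ}
    (hmin : IsLocalMin (fun x => f x - ε * Real.exp (-α * sqDist y x)) p) :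
    ε * Real.exp (-α * sqDist y p) * (4 * α ^ 2 * sqDist y p - 2 * n * α) ≤ lap f p := by
  have hdiff : ∀ {g : (Fin n → ℝ) → ℝ}, ContDiffOn ℝ 1 g Ω → ∀ x ∈ Ω, DifferentiableAt ℝ g x :=
    fun hg x hx => (hg.contDiffAt (hΩ.mem_nhds hx)).differentiableAt (by norm_num)
  have hi : ∀ i : Fin n, ε * Real.exp (-α * sqDist y p) * (4 * α ^ 2 * (p i - y i) ^ 2 - 2 * α)
      ≤ pd2 i i f p := by
    intro i
    set b := p i - y i with hb
    set L : ℝ → Fin n → ℝ := fun t => p + t • Pi.single i 1 with hL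
    have hL0 : L 0 = p := by simp [hL]
    have hLc : Continuous L := by fun_prop
    set E : ℝ → ℝ := fun t => Real.exp (-α * sqDist y (L t)) with hE
    have hEd : ∀ t, HasDerivAt E (E t * (-α * (2 * b + 2 * t))) t := by
      intro t
      have h₁ : HasDerivAt (fun s : ℝ => -α * (sqDist y p + 2 * b * s + s ^ 2))
          (-α * (2 * b + 2 * t)) t := by
        have := ((((hasDerivAt_id t).const_mul (2 * b)).const_add (sqDist y p)).add
          (hasDerivAt_pow 2 t)).const_mul (-α)
        simpa using this
      have h₂ := h₁.exp
      simpa only [hE, hL, sqDist_line] using h₂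
    have hmem : ∀ᶠ t in 𝓝 (0 : ℝ), L t ∈ Ω :=
      hLc.continuousAt.eventually_mem (by rw [hL0]; exact hΩ.mem_nhds hp)
    set g : ℝ → ℝ := fun t => f (L t) - ε * E t with hg
    have hgd : ∀ᶠ t in 𝓝 (0 : ℝ), HasDerivAt g
        (pd i f (L t) - ε * (E t * (-α * (2 * b + 2 * t)))) t := by
      filter_upwards [hmem] with t ht
      exact (hasDerivAt_line i (hdiff (hf.of_le (by norm_num)) _ ht)).sub ((hEd t).const_mul ε)
    have hgmin : IsLocalMin g 0 := by
      have ht : Tendsto L (𝓝 0) (𝓝 p) := by simpa [hL0] using hLc.tendsto 0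
      have := ht.eventually hmin
      filter_upwards [this] with t ht
      simpa only [hg, hE, hL0] using ht
    have hderiv : deriv g =ᶠ[𝓝 0] fun t => pd i f (L t) - ε * (E t * (-α * (2 * b + 2 * t))) :=
      hgd.mono fun t ht => ht.deriv
    have h₁ : HasDerivAt (fun t : ℝ => pd i f (L t)) (pd2 i i f p) 0 := by
      have := hasDerivAt_line (f := pd i f) (x := p) (t := 0) i
        (hdiff (hf.pd hΩ (by norm_num) i) _ (by simpa using hp))
      simpa [pd2] using this
    have h₂ : HasDerivAt (fun t : ℝ => E t * (-α * (2 * b + 2 * t)))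
        (E 0 * (-α * (2 * b + 2 * 0)) * (-α * (2 * b + 2 * 0)) + E 0 * (-α * 2)) 0 := by
      have h₃ : HasDerivAt (fun t : ℝ => -α * (2 * b + 2 * t)) (-α * 2) 0 := by
        simpa using (((hasDerivAt_id (0 : ℝ)).const_mul 2).const_add (2 * b)).const_mul (-α)
      exact (hEd 0).mul h₃
    have hnonneg := deriv_deriv_nonneg_of_isLocalMin hgmin hgd.self_of_nhds.continuousAt
    have h₄ := h₁.fun_sub (h₂.const_mul ε)
    rw [hderiv.deriv_eq, h₄.deriv] at hnonneg
    have hE0 : E 0 = Real.exp (-α * sqDist y p) := by simp only [hE, hL0]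
    rw [hE0] at hnonneg
    linarith
  calc _ = ∑ i, ε * Real.exp (-α * sqDist y p) * (4 * α ^ 2 * (p i - y i) ^ 2 - 2 * α) := by
        rw [← Finset.mul_sum, Finset.sum_sub_distrib, ← Finset.mul_sum]
        simp [sqDist]
        ring_nf
        simp
    _ ≤ lap f p := Finset.sum_le_sum fun i _ => hi i

end Barrier

section StrongMaximumPrinciple

variable {n : ℕ} {Ω : Set (Fin n → ℝ)} {f C : (Fin n → ℝ) → ℝ}

/-- A nonnegative supersolution cannot vanish at a boundary point of a Euclidean ball on which it is
otherwise positive. -/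
lemma ne_zero_of_pos_on_ball (hΩ : IsOpen Ω) (hf : ContDiffOn ℝ 2 f Ω) (hC : ContinuousOn C Ω)
    (hnonneg : ∀ x ∈ Ω, 0 ≤ f x) (hlap : ∀ x ∈ Ω, lap f x ≤ C x * f x)
    {y z : Fin n → ℝ} (hz : z ∈ Ω) (hyz : z ≠ y)
    (hpos : ∀ x ∈ Ω, sqDist y x ≤ sqDist y z → x ≠ z → 0 < f x) : f z ≠ 0 := by
  intro hfz
  have hd : 0 < sqDist y z := sqDist_pos hyz
  have hnear : ∀ᶠ x in 𝓝 z, x ∈ Ω ∧ sqDist y z / 2 < sqDist y x :=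
    (hΩ.eventually_mem hz).and
      ((continuous_sqDist y).continuousAt.eventually (lt_mem_nhds (half_lt_self hd)))
  obtain ⟨δ, hδ, hball⟩ := Metric.nhds_basis_closedBall.eventually_iff.1 hnear
  have hcpt := isCompact_closedBall z δ
  obtain ⟨K₀, hK₀⟩ := (hcpt.image_of_continuousOn
    (hC.mono fun x hx => (hball hx).1)).bddAbove
  set K := max K₀ 0
  have hK : ∀ x ∈ Metric.closedBall z δ, C x ≤ K := fun x hx =>
    (hK₀ (mem_image_of_mem C hx)).trans (le_max_left _ _)
  have hK0 : 0 ≤ K := le_max_right _ _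
  set α : ℝ := 1 + (2 * n + K + 1) / (2 * sqDist y z) with hα
  have hα1 : 1 ≤ α := by
    have : 0 ≤ (2 * n + K + 1) / (2 * sqDist y z) := by positivity
    linarith
  have hαd : 2 * n + K + 1 ≤ 2 * α * sqDist y z := by
    have : 2 * α * sqDist y z = 2 * sqDist y z + (2 * n + K + 1) := by
      rw [hα]
      field_simp
    linarith
  set E : (Fin n → ℝ) → ℝ := fun x => Real.exp (-α * sqDist y x) with hE
  have hEc : Continuous E := by fun_prop
  have hE0 : ∀ x, 0 < E x := fun x => Real.exp_pos _
  have hE1 : ∀ x, E x ≤ 1 := fun x => Real.exp_le_one_iff.2 (by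
    have : 0 ≤ sqDist y x := Finset.sum_nonneg fun j _ => sq_nonneg _
    nlinarith)
  have hsub : Metric.sphere z δ ⊆ Metric.closedBall z δ := Metric.sphere_subset_closedBall
  have hfc : ContinuousOn f (Metric.closedBall z δ) :=
    hf.continuousOn.mono fun x hx => (hball hx).1
  obtain ⟨ε, hε, hεf⟩ : ∃ ε > 0, ∀ x ∈ Metric.sphere z δ, sqDist y x ≤ sqDist y z → ε ≤ f x := by
    set S := Metric.sphere z δ ∩ {x | sqDist y x ≤ sqDist y z}
    have hS : IsCompact S :=
      (isCompact_sphere z δ).inter_right (isClosed_le (continuous_sqDist y) continuous_const)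
    rcases S.eq_empty_or_nonempty with h | h
    · exact ⟨1, one_pos, fun x hx hx' => absurd (show x ∈ S from ⟨hx, hx'⟩) (by simp [h])⟩
    · obtain ⟨q, hq, hqmin⟩ := hS.exists_isMinOn h
        (hfc.mono (inter_subset_left.trans hsub))
      refine ⟨f q, hpos q (hball (hsub hq.1)).1 hq.2 ?_, fun x hx hx' => hqmin ⟨hx, hx'⟩⟩
      exact Metric.ne_of_mem_sphere hq.1 hδ.ne'
  have hsphere : ∀ x ∈ Metric.sphere z δ, f z - ε * E z < f x - ε * E x := by
    intro x hx
    have hEz := hE0 z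
    rw [hfz]
    by_cases h : sqDist y x ≤ sqDist y z
    · have h₁ := hεf x hx h
      nlinarith [hE1 x]
    · have h₁ : E x < E z := Real.exp_lt_exp.2 (by nlinarith)
      have h₂ := hnonneg x (hball (hsub hx)).1
      nlinarith
  obtain ⟨p, hp, hpmin⟩ := hcpt.exists_isMinOn ⟨z, Metric.mem_closedBall_self hδ.le⟩
    (hfc.sub (continuous_const.mul hEc).continuousOn : ContinuousOn (fun x => f x - ε * E x) _)
  have hpz : f p - ε * E p ≤ f z - ε * E z := hpmin (Metric.mem_closedBall_self hδ.le)
  have hpball : p ∈ Metric.ball z δ := by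
    rcases (Metric.mem_closedBall.1 hp).lt_or_eq with h | h
    · exact h
    · exact absurd hpz (not_le.2 (hsphere p h))
  have hlocal : IsLocalMin (fun x => f x - ε * E x) p :=
    hpmin.isLocalMin (mem_of_superset (Metric.isOpen_ball.mem_nhds hpball)
      Metric.ball_subset_closedBall)
  obtain ⟨hpΩ, hpd⟩ := hball hp
  have h₁ := le_lap_of_isLocalMin hΩ hf hpΩ hlocal
  have h₂ := hlap p hpΩ
  have h₃ : C p * f p ≤ K * f p := mul_le_mul_of_nonneg_right (hK p hp) (hnonneg p hpΩ)
  have h₄ : f p ≤ ε * E p := by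
    rw [hfz] at hpz
    nlinarith [hE0 z]
  have h₅ : K + 1 ≤ 4 * α ^ 2 * sqDist y p - 2 * n * α := by
    have : K + 1 ≤ 4 * α * sqDist y p - 2 * n := by nlinarith
    nlinarith
  have h₆ : K * f p ≤ K * (ε * E p) := mul_le_mul_of_nonneg_left h₄ hK0
  have h₇ : 0 < ε * E p := mul_pos hε (hE0 p)
  have h₈ := mul_le_mul_of_nonneg_left h₅ h₇.le
  linarith

/-- The zero set of a nonnegative supersolution is open. -/
lemma eventually_eq_zero_of_lap_le (hΩ : IsOpen Ω) (hf : ContDiffOn ℝ 2 f Ω)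
    (hC : ContinuousOn C Ω) (hnonneg : ∀ x ∈ Ω, 0 ≤ f x) (hlap : ∀ x ∈ Ω, lap f x ≤ C x * f x)
    {x₀ : Fin n → ℝ} (hx₀ : x₀ ∈ Ω) (hfx₀ : f x₀ = 0) : ∀ᶠ x in 𝓝 x₀, f x = 0 := by
  obtain ⟨ρ, hρ, hball⟩ := Metric.nhds_basis_closedBall.mem_iff.1 (hΩ.mem_nhds hx₀)
  have hn : (0 : ℝ) < n + 1 := by positivity
  filter_upwards [Metric.closedBall_mem_nhds x₀ (div_pos hρ hn)] with y hy
  have hy' : (n + 1) * dist y x₀ ≤ ρ := by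
    rw [Metric.mem_closedBall, le_div_iff₀ hn] at hy
    linarith
  have hfc : ContinuousOn f (Metric.closedBall x₀ ρ) := hf.continuousOn.mono hball
  set Z := Metric.closedBall x₀ ρ ∩ f ⁻¹' {0}
  have hZ : IsCompact Z :=
    (isCompact_closedBall x₀ ρ).of_isClosed_subset
      (hfc.preimage_isClosed_of_isClosed Metric.isClosed_closedBall isClosed_singleton)
      inter_subset_left
  have hx₀Z : x₀ ∈ Z := ⟨Metric.mem_closedBall_self hρ.le, hfx₀⟩
  obtain ⟨z, hz, hzmin⟩ := hZ.exists_isMinOn ⟨x₀, hx₀Z⟩ (continuous_sqDist y).continuousOn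
  by_contra hfy
  have hzy : z ≠ y := fun h => hfy (h ▸ hz.2)
  have hmid : z ≠ fun j => (y j + z j) / 2 := fun h => hzy (funext fun j => by
    have := congrFun h j
    linarith)
  refine ne_zero_of_pos_on_ball hΩ hf hC hnonneg hlap (hball hz.1) hmid (fun x hx hxd hxz => ?_)
    hz.2
  have hlt := sqDist_lt_of_sqDist_midpoint_le hxz hxd
  refine (hnonneg x hx).lt_of_ne fun h => hlt.not_ge (hzmin ⟨?_, h.symm⟩)
  have h₁ := dist_le_of_sqDist_le (hlt.le.trans (hzmin hx₀Z))
  have h₂ := dist_triangle x y x₀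
  rw [dist_comm x₀ y] at h₁
  rw [Metric.mem_closedBall]
  linarith

/-- The strong maximum principle: a nonnegative solution of `Δ f ≤ C f` on a connected open set
which vanishes at a point vanishes identically. -/
theorem eq_zero_of_lap_le (hΩ : IsOpen Ω) (hΩc : IsPreconnected Ω) (hf : ContDiffOn ℝ 2 f Ω)
    (hC : ContinuousOn C Ω) (hnonneg : ∀ x ∈ Ω, 0 ≤ f x) (hlap : ∀ x ∈ Ω, lap f x ≤ C x * f x)
    {x₀ : Fin n → ℝ} (hx₀ : x₀ ∈ Ω) (hfx₀ : f x₀ = 0) : ∀ x ∈ Ω, f x = 0 := by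
  have hopen : ∀ x ∈ Ω, f x = 0 → x ∈ interior {x | f x = 0} := fun x hx hfx =>
    mem_interior_iff_mem_nhds.2 (eventually_eq_zero_of_lap_le hΩ hf hC hnonneg hlap hx hfx)
  have hsub : Ω ⊆ interior {x | f x = 0} := by
    refine hΩc.subset_of_closure_inter_subset isOpen_interior ⟨x₀, hx₀, hopen x₀ hx₀ hfx₀⟩ ?_
    rintro x ⟨hx, hxΩ⟩
    refine hopen x hxΩ ?_
    by_contra hne
    have hev := (hf.continuousOn.continuousAt (hΩ.mem_nhds hxΩ)).eventually_ne hne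
    obtain ⟨w, hw, hw'⟩ := (mem_closure_iff_frequently.1 hx |>.and_eventually hev).exists
    exact hw' (interior_subset (s := {x | f x = 0}) hw)
  exact fun x hx => interior_subset (s := {x | f x = 0}) (hsub hx)

end StrongMaximumPrinciple

lemma pd2_const_mul_rpow {n : ℕ} {Ω : Set (Fin n → ℝ)} (hΩ : IsOpen Ω) {u : (Fin n → ℝ) → ℝ}
    (hu : ContDiffOn ℝ 2 u Ω) (hupos : ∀ x ∈ Ω, 0 < u x) (c p : ℝ) (i : Fin n)
    {x : Fin n → ℝ} (hx : x ∈ Ω) :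
    pd2 i i (fun y => c * u y ^ p) x
      = c * p * ((p - 1) * u x ^ (p - 2) * pd i u x ^ 2 + u x ^ (p - 1) * pd2 i i u x) := by
  have hdiff : ∀ {g : (Fin n → ℝ) → ℝ}, ContDiffOn ℝ 1 g Ω → ∀ x ∈ Ω, DifferentiableAt ℝ g x :=
    fun hg x hx => (hg.contDiffAt (hΩ.mem_nhds hx)).differentiableAt (by norm_num)
  have hud : ∀ x ∈ Ω, HasFDerivAt u (fderiv ℝ u x) x := fun x hx =>
    (hdiff (hu.of_le (by norm_num)) x hx).hasFDerivAt
  have h₁ : EqOn (pd i (fun y => c * u y ^ p)) (fun y => c * p * (u y ^ (p - 1) * pd i u y)) Ω := by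
    intro y hy
    have := ((hud y hy).rpow_const (p := p) (Or.inl (hupos y hy).ne')).const_mul c
    simp only [pd]
    rw [this.fderiv]
    simp
    ring
  have h₂ : HasFDerivAt (pd i u) (fderiv ℝ (pd i u) x) x :=
    (hdiff (hu.pd hΩ (by norm_num) i) x hx).hasFDerivAt
  have h₃ := (((hud x hx).rpow_const (p := p - 1) (Or.inl (hupos x hx).ne')).fun_mul h₂).const_mul
    (c * p)
  have h₄ : pd2 i i (fun y => c * u y ^ p) x = _ := h₁.pd hΩ i hx
  rw [h₄, pd, h₃.fderiv, show p - 1 - 1 = p - 2 by ring]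
  have h₅ : pd2 i i u x = fderiv ℝ (pd i u) x (Pi.single i 1) := rfl
  have h₆ : pd i u x = fderiv ℝ u x (Pi.single i 1) := rfl
  simp only [h₅, h₆, smul_apply, add_apply, smul_eq_mul]
  ring

theorem stmt9 {n : ℕ} (hn : 3 ≤ n) (Ω : Set (Fin n → ℝ)) (hΩ : IsOpen Ω)
    (hΩc : IsConnected Ω)
    (u : (Fin n → ℝ) → ℝ) (hu : ContDiffOn ℝ (⊤ : ℕ∞) u Ω)
    (hupos : ∀ x ∈ Ω, 0 < u x)
    (hpde : ∀ x ∈ Ω,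
      lap u x = ((n : ℝ) * ((n : ℝ) - 2) / 4) * u x ^ (((n : ℝ) + 2) / ((n : ℝ) - 2)))
    (hpsd : ∀ x ∈ Ω, (Mmat u x).PosSemidef)
    (x₀ : Fin n → ℝ) (hx₀ : x₀ ∈ Ω) (i : Fin n)
    (hMii : Mmat u x₀ i i = 0)
    (hgrad : ∀ j : Fin n, pd j u x₀ = 0) :
    ∀ x ∈ Ω, pd2 i i u x = 0 := by
  have hn3 : (3 : ℝ) ≤ n := by exact_mod_cast hn
  have hn2 : (0 : ℝ) < (n : ℝ) - 2 := by linarith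
  have hu2 : ContDiffOn ℝ 2 u Ω := hu.of_le ENat.LEInfty.out
  have hsmooth : ContDiffOn ℝ (⊤ : ℕ∞) (pd2 i i u) Ω :=
    (hu.pd hΩ (m := (⊤ : ℕ∞)) (by simp) i).pd hΩ (by simp) i
  have hM : ∀ x ∈ Ω, (n : ℝ) * pd i u x ^ 2 ≤ ((n : ℝ) - 2) * (u x * pd2 i i u x) := by
    intro x hx
    have hux := hupos x hx
    have h := (hpsd x hx).diag_nonneg (i := i)
    have heq : Mmat u x i i * (((n : ℝ) - 2) * u x ^ 2)
        = ((n : ℝ) - 2) * (u x * pd2 i i u x) - n * pd i u x ^ 2 := by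
      simp only [Mmat, Matrix.of_apply]
      field_simp
    have := mul_nonneg h (by positivity : 0 ≤ ((n : ℝ) - 2) * u x ^ 2)
    linarith
  have hnonneg : ∀ x ∈ Ω, 0 ≤ pd2 i i u x := by
    intro x hx
    have h : 0 ≤ ((n : ℝ) - 2) * u x * pd2 i i u x := by
      have := hM x hx
      have : 0 ≤ (n : ℝ) * pd i u x ^ 2 := by positivity
      linarith
    exact nonneg_of_mul_nonneg_right h (mul_pos hn2 (hupos x hx))
  have hzero : pd2 i i u x₀ = 0 := by
    simp only [Mmat, Matrix.of_apply, hgrad, mul_zero, zero_div, sub_zero] at hMii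
    exact (div_eq_zero_iff.1 hMii).resolve_right (hupos x₀ hx₀).ne'
  refine eq_zero_of_lap_le (C := fun x => ((n : ℝ) + 2) * (n + 4) / 4 * u x ^ (4 / ((n : ℝ) - 2)))
    hΩ hΩc.isPreconnected (hsmooth.of_le ENat.LEInfty.out)
    (continuousOn_const.mul (hu.continuousOn.rpow_const fun x hx => Or.inl (hupos x hx).ne'))
    hnonneg (fun x hx => ?_) hx₀ hzero
  have hux := hupos x hx
  have hpde' : EqOn (lap u) (fun y => ((n : ℝ) * ((n : ℝ) - 2) / 4)
      * u y ^ (((n : ℝ) + 2) / ((n : ℝ) - 2))) Ω := hpde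
  have hdiff : pd2 i i (lap u) x = _ := (hpde'.pd hΩ i).pd hΩ i hx
  have hcalc := pd2_const_mul_rpow hΩ hu2 hupos ((n : ℝ) * ((n : ℝ) - 2) / 4)
    (((n : ℝ) + 2) / ((n : ℝ) - 2)) i hx
  rw [lap_pd2 hΩ hu i hx, hdiff]
  refine hcalc.trans_le ?_
  set q := 4 / ((n : ℝ) - 2) with hq
  have hp1 : ((n : ℝ) + 2) / ((n : ℝ) - 2) - 1 = q := by
    rw [hq]
    field_simp
    ring
  have hp2 : ((n : ℝ) + 2) / ((n : ℝ) - 2) - 2 = q - 1 := by linarith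
  have hc : (n : ℝ) * ((n : ℝ) - 2) / 4 * (((n : ℝ) + 2) / ((n : ℝ) - 2)) = n * (n + 2) / 4 := by
    field_simp
  rw [hp1, hp2, hc, Real.rpow_sub_one hux.ne']
  have hA : 0 < u x ^ q := Real.rpow_pos_of_pos hux q
  have hkey : (n : ℝ) * q * (u x ^ q / u x) * pd i u x ^ 2 ≤ 4 * u x ^ q * pd2 i i u x := by
    have h := mul_le_mul_of_nonneg_left (hM x hx)
      (by positivity : 0 ≤ q * (u x ^ q / u x))
    have heq : q * (u x ^ q / u x) * (((n : ℝ) - 2) * (u x * pd2 i i u x))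
        = 4 * u x ^ q * pd2 i i u x := by
      rw [hq]
      field_simp
    linarith
  have h := mul_le_mul_of_nonneg_left hkey (by positivity : 0 ≤ ((n : ℝ) + 2) / 4)
  linarith
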